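/- Let p ∈ (1,∞) with p ≠ 2, and let η : ℝ³ → ℝ³ be an affine map. Then η is an infinitesimal rigid motion of ℓ_{2,p}³ if and only if there exist λ ∈ ℝ and c ∈ ℝ³ such that η(x₁,x₂,x₃) = λ(−x₂, x₁, 0) + c for all (x₁,x₂,x₃) ∈ ℝ³. In particular, the real vector space of affine infinitesimal rigid motions of ℓ_{2,p}³ has dimension 4. -/

import Mathlib

/-- The mixed (2,p)-norm on ℝ³: ‖(x,y,z)‖_{2,p} = ((x²+y²)^{p/2} + |z|^p)^{1/p}. -/
noncomputable def norm2p (p : ℝ) (v : Fin 3 → ℝ) : ℝ :=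
  ((v 0 ^ 2 + v 1 ^ 2) ^ (p / 2) + |v 2| ^ p) ^ (1 / p)

/-- α = {α_x : [−1,1] → ℝ³} is a rigid motion of ℓ_{2,p}³. -/
def RigidMotion (p : ℝ) (α : (Fin 3 → ℝ) → ℝ → (Fin 3 → ℝ)) : Prop :=
  (∀ x, ContinuousOn (α x) (Set.Icc (-1) 1)) ∧
  (∀ x, α x 0 = x) ∧
  (∀ x y, ∀ t ∈ Set.Icc (-1 : ℝ) 1, norm2p p (α x t - α y t) = norm2p p (x - y))

/-- η is an infinitesimal rigid motion of ℓ_{2,p}³: there is a rigid motion α of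
ℓ_{2,p}³ such that each path α_x is differentiable at t = 0 with derivative η(x). -/
def InfRigidMotion (p : ℝ) (η : (Fin 3 → ℝ) → (Fin 3 → ℝ)) : Prop :=
  ∃ α : (Fin 3 → ℝ) → ℝ → (Fin 3 → ℝ), RigidMotion p α ∧
    ∀ x, HasDerivWithinAt (α x) (η x) (Set.Icc (-1) 1) 0

open Set in
/-- Differentiating the `p`-th power of the constant norm of `α x t - α 0 t` at `t = 0`. -/
theorem InfRigidMotion.orthogonality {p : ℝ} (hp : 1 < p) {η : (Fin 3 → ℝ) → (Fin 3 → ℝ)}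
    (h : InfRigidMotion p η) (x : Fin 3 → ℝ) (hx : 0 < x 0 ^ 2 + x 1 ^ 2) :
    (x 0 ^ 2 + x 1 ^ 2) ^ (p / 2 - 1) * (x 0 * (η x - η 0) 0 + x 1 * (η x - η 0) 1) +
      |x 2| ^ (p - 2) * x 2 * (η x - η 0) 2 = 0 := by
  obtain ⟨α, ⟨-, h0, hiso⟩, hd⟩ := h
  have hmem : (0 : ℝ) ∈ Icc (-1 : ℝ) 1 := by norm_num
  set d : ℝ → Fin 3 → ℝ := fun t => α x t - α 0 t with hd_def
  have hd0 : d 0 = x := by simp [hd_def, h0]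
  have hdd : HasDerivWithinAt d (η x - η 0) (Icc (-1) 1) 0 := (hd x).sub (hd 0)
  have hdi := hasDerivWithinAt_pi.1 hdd
  have hsq : HasDerivWithinAt (fun t => d t 0 ^ 2 + d t 1 ^ 2)
      (2 * (x 0 * (η x - η 0) 0 + x 1 * (η x - η 0) 1)) (Icc (-1) 1) 0 := by
    refine (((hdi 0).pow 2).add ((hdi 1).pow 2)).congr_deriv ?_
    rw [hd0]; push_cast; ring
  have hpow := hsq.rpow_const (p := p / 2) (Or.inl (by rw [hd0]; exact hx.ne'))
  have habs := (hasDerivAt_abs_rpow (d 0 2) hp).comp_hasDerivWithinAt 0 (hdi 2)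
  have hF := hpow.add habs
  have hconst : ∀ t ∈ Icc (-1 : ℝ) 1, (d t 0 ^ 2 + d t 1 ^ 2) ^ (p / 2) + |d t 2| ^ p =
      (x 0 ^ 2 + x 1 ^ 2) ^ (p / 2) + |x 2| ^ p := by
    intro t ht
    have := hiso x 0 t ht
    rw [sub_zero] at this
    unfold norm2p at this
    exact (Real.rpow_left_inj (by positivity) (by positivity) (by positivity)).1 this
  have hc : HasDerivWithinAt (fun t => (d t 0 ^ 2 + d t 1 ^ 2) ^ (p / 2) + |d t 2| ^ p) 0
      (Icc (-1) 1) 0 :=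
    (hasDerivWithinAt_const (0 : ℝ) (Icc (-1 : ℝ) 1) _).congr hconst (hconst 0 hmem)
  have hu : UniqueDiffWithinAt ℝ (Icc (-1 : ℝ) 1) 0 := uniqueDiffOn_Icc (by norm_num) 0 hmem
  have key := hu.eq_deriv _ hF hc
  simp only [hd0] at key
  have hp0 : p ≠ 0 := by positivity
  apply mul_left_cancel₀ hp0
  linear_combination key

/-- The infinitesimal rotation about the third axis with speed `lam`, plus the translation `c`. -/
def rotationAddTranslation : (ℝ × (Fin 3 → ℝ)) →ₗ[ℝ] ((Fin 3 → ℝ) → (Fin 3 → ℝ)) where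
  toFun q := fun x => q.1 • ![-(x 1), x 0, 0] + q.2
  map_add' q r := by
    funext x
    simp only [Prod.fst_add, Prod.snd_add, Pi.add_apply, add_smul]
    abel
  map_smul' a q := by
    funext x
    simp only [Prod.smul_fst, Prod.smul_snd, Pi.smul_apply, RingHom.id_apply, smul_add, smul_assoc]

theorem rotationAddTranslation_apply (q : ℝ × (Fin 3 → ℝ)) (x : Fin 3 → ℝ) (i : Fin 3) :
    rotationAddTranslation q x i = q.1 * ![-(x 1), x 0, 0] i + q.2 i :=
  rfl

theorem rotationAddTranslation_injective : Function.Injective rotationAddTranslation := by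
  rw [← LinearMap.ker_eq_bot, LinearMap.ker_eq_bot']
  rintro ⟨l, c⟩ h
  have hc : c = 0 := by
    funext i
    have := congrFun (congrFun h 0) i
    fin_cases i <;> simpa [rotationAddTranslation_apply] using this
  subst hc
  have hl := congrFun (congrFun h ![1, 0, 0]) 1
  simp [rotationAddTranslation_apply] at hl
  simp [hl]

theorem rotationAddTranslation_isAffine (q : ℝ × (Fin 3 → ℝ)) :
    ∃ (A : (Fin 3 → ℝ) →ₗ[ℝ] (Fin 3 → ℝ)) (b : Fin 3 → ℝ),
      ∀ x, rotationAddTranslation q x = A x + b := by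
  refine ⟨⟨⟨fun x => q.1 • ![-(x 1), x 0, 0], fun x y => ?_⟩, fun a x => ?_⟩, q.2, fun x => rfl⟩
  · ext i; fin_cases i <;> simp <;> ring
  · ext i; fin_cases i <;> simp <;> ring

theorem rotationAddTranslation_infRigidMotion (p : ℝ) (q : ℝ × (Fin 3 → ℝ)) :
    InfRigidMotion p (rotationAddTranslation q) := by
  obtain ⟨l, c⟩ := q
  let α : (Fin 3 → ℝ) → ℝ → (Fin 3 → ℝ) := fun x t =>
    ![Real.cos (l * t) * x 0 - Real.sin (l * t) * x 1 + t * c 0,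
      Real.sin (l * t) * x 0 + Real.cos (l * t) * x 1 + t * c 1, x 2 + t * c 2]
  refine ⟨α, ⟨fun x => ?_, fun x => ?_, fun x y t _ => ?_⟩, fun x => ?_⟩
  · refine Continuous.continuousOn (continuous_pi fun i => ?_)
    fin_cases i <;> simp [α] <;> fun_prop
  · ext i; fin_cases i <;> simp [α]
  · have h01 : (α x t - α y t) 0 ^ 2 + (α x t - α y t) 1 ^ 2 = (x - y) 0 ^ 2 + (x - y) 1 ^ 2 := by
      simp [α]
      linear_combination ((x 0 - y 0) ^ 2 + (x 1 - y 1) ^ 2) * Real.sin_sq_add_cos_sq (l * t)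
    have h2 : (α x t - α y t) 2 = (x - y) 2 := by simp [α]
    simp only [norm2p, h01, h2]
  · apply HasDerivAt.hasDerivWithinAt
    have hm : HasDerivAt (fun t : ℝ => l * t) l 0 := by
      simpa using (hasDerivAt_id (0 : ℝ)).const_mul l
    have hs : HasDerivAt (fun t => Real.sin (l * t)) l 0 := by simpa using hm.sin
    have hcos : HasDerivAt (fun t => Real.cos (l * t)) 0 0 := by simpa using hm.cos
    have ht (a : ℝ) : HasDerivAt (fun t : ℝ => t * a) a 0 := by
      simpa using (hasDerivAt_id (0 : ℝ)).mul_const a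
    refine hasDerivAt_pi.2 fun i => ?_
    fin_cases i
    · exact (((hcos.mul_const (x 0)).sub (hs.mul_const (x 1))).add (ht (c 0))).congr_deriv
        (by simp [rotationAddTranslation_apply])
    · exact (((hs.mul_const (x 0)).add (hcos.mul_const (x 1))).add (ht (c 1))).congr_deriv
        (by simp [rotationAddTranslation_apply])
    · exact ((ht (c 2)).const_add (x 2)).congr_deriv (by simp [rotationAddTranslation_apply])

theorem InfRigidMotion.exists_eq_rotationAddTranslation {p : ℝ} (hp1 : 1 < p) (hp2 : p ≠ 2)
    {η : (Fin 3 → ℝ) → (Fin 3 → ℝ)} {A : (Fin 3 → ℝ) →ₗ[ℝ] (Fin 3 → ℝ)} {b : Fin 3 → ℝ}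
    (hη : ∀ x, η x = A x + b) (h : InfRigidMotion p η) :
    ∃ q, rotationAddTranslation q = η := by
  set M := LinearMap.toMatrix' A with hM
  have hA (x : Fin 3 → ℝ) (i : Fin 3) : A x i = M i 0 * x 0 + M i 1 * x 1 + M i 2 * x 2 := by
    have : A x = M.mulVec x := by rw [hM, LinearMap.toMatrix'_mulVec]
    rw [this]
    simp [Matrix.mulVec, dotProduct, Fin.sum_univ_three]
  have orth (x : Fin 3 → ℝ) (hx : 0 < x 0 ^ 2 + x 1 ^ 2) :
      (x 0 ^ 2 + x 1 ^ 2) ^ (p / 2 - 1) * (x 0 * A x 0 + x 1 * A x 1) +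
        |x 2| ^ (p - 2) * x 2 * A x 2 = 0 := by
    have := h.orthogonality hp1 x hx
    simpa [hη] using this
  have two_pow : (2 : ℝ) ^ (p - 2) ≠ 1 := by
    intro h2
    rw [← Real.rpow_zero (2 : ℝ)] at h2
    exact hp2 (by linarith [Real.rpow_right_inj (by norm_num) (by norm_num) |>.1 h2])
  have e0 := orth ![1, 0, 0] (by simp)
  have e1 := orth ![0, 1, 0] (by simp)
  have e01 := orth ![1, 1, 0] (by simp)
  have f0 := orth ![1, 0, 1] (by simp)
  have f1 := orth ![0, 1, 1] (by simp)
  have g0 := orth ![1, 0, -1] (by simp)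
  have k0 := orth ![1, 0, 2] (by simp)
  have k1 := orth ![0, 1, 2] (by simp)
  simp [hA] at e0 e1 e01 f0 f1 g0 k0 k1
  have hpos : (1 + 1 : ℝ) ^ (p / 2 - 1) ≠ 0 := by positivity
  have h01 : M 0 1 = -M 1 0 := by linarith [e01.resolve_left hpos]
  have h22 : M 2 2 = 0 := by linarith
  have h20 : M 2 0 = 0 := by
    have : (2 ^ (p - 2) - 1) * M 2 0 = 0 := by
      linear_combination k0 / 2 - f0 + e0 / 2 + (1 - 2 * 2 ^ (p - 2)) * h22
    exact (mul_eq_zero.1 this).resolve_left (sub_ne_zero.2 two_pow)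
  have h21 : M 2 1 = 0 := by
    have : (2 ^ (p - 2) - 1) * M 2 1 = 0 := by
      linear_combination k1 / 2 - f1 + e1 / 2 + (1 - 2 * 2 ^ (p - 2)) * h22
    exact (mul_eq_zero.1 this).resolve_left (sub_ne_zero.2 two_pow)
  have h02 : M 0 2 = 0 := by linarith
  have h12 : M 1 2 = 0 := by linarith
  refine ⟨(M 1 0, b), funext fun x => ?_⟩
  rw [hη]
  ext i
  rw [Pi.add_apply, hA]
  fin_cases i <;> simp [rotationAddTranslation_apply, e0, e1, h01, h22, h20, h21, h02, h12]

theorem stmt15 (p : ℝ) (hp1 : 1 < p) (hp2 : p ≠ 2) :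
    (∀ (η : (Fin 3 → ℝ) → (Fin 3 → ℝ)) (A : (Fin 3 → ℝ) →ₗ[ℝ] (Fin 3 → ℝ))
        (b : Fin 3 → ℝ), (∀ x, η x = A x + b) →
      (InfRigidMotion p η ↔
        ∃ (lam : ℝ) (c : Fin 3 → ℝ), ∀ x, η x = lam • ![-(x 1), x 0, 0] + c)) ∧
    Module.finrank ℝ
      (Submodule.span ℝ {η : (Fin 3 → ℝ) → (Fin 3 → ℝ) |
        (∃ (A : (Fin 3 → ℝ) →ₗ[ℝ] (Fin 3 → ℝ)) (b : Fin 3 → ℝ), ∀ x, η x = A x + b) ∧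
          InfRigidMotion p η}) = 4 := by
  have char (η : (Fin 3 → ℝ) → (Fin 3 → ℝ)) (A : (Fin 3 → ℝ) →ₗ[ℝ] (Fin 3 → ℝ))
      (b : Fin 3 → ℝ) (hη : ∀ x, η x = A x + b) :
      InfRigidMotion p η ↔ ∃ q, rotationAddTranslation q = η :=
    ⟨fun h => h.exists_eq_rotationAddTranslation hp1 hp2 hη,
      fun ⟨q, hq⟩ => hq ▸ rotationAddTranslation_infRigidMotion p q⟩
  refine ⟨fun η A b hη => (char η A b hη).trans
    ⟨fun ⟨q, hq⟩ => ⟨q.1, q.2, fun x => (congrFun hq x).symm⟩,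
      fun ⟨l, c, hlc⟩ => ⟨(l, c), funext fun x => (hlc x).symm⟩⟩, ?_⟩
  have hset : {η : (Fin 3 → ℝ) → (Fin 3 → ℝ) |
      (∃ (A : (Fin 3 → ℝ) →ₗ[ℝ] (Fin 3 → ℝ)) (b : Fin 3 → ℝ), ∀ x, η x = A x + b) ∧
        InfRigidMotion p η} = (LinearMap.range rotationAddTranslation : Set _) := by
    ext η
    constructor
    · rintro ⟨⟨A, b, hη⟩, h⟩
      exact (char η A b hη).1 h
    · rintro ⟨q, rfl⟩
      exact ⟨rotationAddTranslation_isAffine q, rotationAddTranslation_infRigidMotion p q⟩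
  rw [hset, Submodule.span_eq, LinearMap.finrank_range_of_inj rotationAddTranslation_injective]
  simp
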